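/- Let K = (K, O_1, O_2) be a field of characteristic p > 0 equipped with two valuation rings O_1 and O_2, viewed as a structure in the language of rings expanded by two unary predicates for O_1 and O_2. If every existential formula of this language is NIP with respect to Th(K), then O_1 and O_2 are comparable (one is contained in the other). -/

import Mathlib

open FirstOrder Language

namespace NIPPaper

universe u v

/-- A partitioned formula `φ(x, y)` has the independence property (IP) with respect to the
theory `T` if in some model of `T` there are sequences `(aᵢ : i < ω)` and `(b_S : S ⊆ ω)`
such that `φ(aᵢ, b_S)` holds iff `i ∈ S`. -/
def Theory.HasIP {L : FirstOrder.Language.{u, v}} (T : L.Theory) {α β : Type}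
    (φ : L.Formula (α ⊕ β)) : Prop :=
  ∃ (M : Theory.ModelType.{u, v, max u v} T) (a : ℕ → α → M) (b : Set ℕ → β → M),
    ∀ (i : ℕ) (s : Set ℕ), φ.Realize (Sum.elim (a i) (b s)) ↔ i ∈ s

/-- Prenex classes `Σₙ` (`b = true`) and `Πₙ` (`b = false`), counting alternating blocks of
quantifiers; `IsEA true 1 φ` says that `φ` is an existential formula: a block of
existential quantifiers followed by a quantifier-free formula. -/
inductive IsEA {L : FirstOrder.Language.{u, v}} :
    Bool → ℕ → ∀ {α : Type} {k : ℕ}, L.BoundedFormula α k → Prop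
  | of_isQF {b : Bool} {n : ℕ} {α : Type} {k : ℕ} {φ : L.BoundedFormula α k} :
      φ.IsQF → IsEA b n φ
  | ex {n : ℕ} {α : Type} {k : ℕ} {φ : L.BoundedFormula α (k + 1)} :
      IsEA true (n + 1) φ → IsEA true (n + 1) φ.ex
  | all {n : ℕ} {α : Type} {k : ℕ} {φ : L.BoundedFormula α (k + 1)} :
      IsEA false (n + 1) φ → IsEA false (n + 1) φ.all
  | of_flip {b : Bool} {n : ℕ} {α : Type} {k : ℕ} {φ : L.BoundedFormula α k} :
      IsEA b n φ → IsEA (!b) (n + 1) φ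

/-- Existential formulas. -/
def IsExistential {L : FirstOrder.Language.{u, v}} {α : Type} {k : ℕ}
    (φ : L.BoundedFormula α k) : Prop := IsEA true 1 φ

/-- A theory is `E`-NIP if all of its existential formulas are NIP. -/
def Theory.IsExNIP {L : FirstOrder.Language.{u, v}} (T : L.Theory) : Prop :=
  ∀ (a b : ℕ) (φ : L.Formula (Fin a ⊕ Fin b)), IsExistential φ → ¬ Theory.HasIP T φ

/-- The relation symbols of the language consisting of two unary predicates. -/
def predRel : ℕ → Type | 1 => Bool | _ => Empty

/-- The language with two unary predicates (and no function symbols). -/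
def ovLang : FirstOrder.Language.{0, 0} :=
  { Functions := fun _ => Empty, Relations := predRel }

/-- The language of rings expanded by two unary predicates (for two valuation rings). -/
def ringPredLang : FirstOrder.Language.{0, 0} := Language.ring.sum ovLang

/-- The `ringPredLang`-structure associated to a field `K` together with two valuation
subrings `O₁`, `O₂`: the ring symbols are interpreted by the field operations, and the
two unary predicates by membership in `O₁` and `O₂` respectively. -/
noncomputable def valuedFieldStructure (K : Type) [Field K] (O₁ O₂ : ValuationSubring K) :
    ringPredLang.Structure K :=
  letI : Language.ring.Structure K := (FirstOrder.Ring.compatibleRingOfRing K).toStructure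
  letI : ovLang.Structure K :=
    { funMap := fun {n} f _ => Empty.elim f
      RelMap := fun {n} r x =>
        match n, r with
        | 1, true => x 0 ∈ O₁
        | 1, false => x 0 ∈ O₂
        | 0, r => Empty.elim r
        | (_ + 2), r => Empty.elim r }
  Language.sumStructure _ _ K

/-- The complete theory of the `2`-valued field `(K, O₁, O₂)` in the language of rings
with two predicates for the valuation rings. -/
noncomputable def valuedFieldTheory (K : Type) [Field K] (O₁ O₂ : ValuationSubring K) :
    ringPredLang.Theory :=
  letI := valuedFieldStructure K O₁ O₂
  ringPredLang.completeTheory K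

section Algebra

open Polynomial

section SubspacePolynomial

variable {A B : Type*} [CommRing A] [CommRing B] (p : ℕ)

/-- The additive polynomial, of degree `p ^ L.length`, whose roots are the `𝔽_p`-linear
combinations of the entries of `L`, evaluated at `u`. -/
def subspaceEval : List A → A → A
  | [], u => u
  | v :: L, u => subspaceEval L u ^ p - subspaceEval L v ^ (p - 1) * subspaceEval L u

theorem map_subspaceEval (f : A →+* B) (L : List A) (u : A) :
    f (subspaceEval p L u) = subspaceEval p (L.map f) (f u) := by
  induction L generalizing u with
  | nil => rfl
  | cons v L ih => simp [subspaceEval, ih]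

theorem dvd_subspaceEval [hp : Fact p.Prime] (L : List A) (u : A) : u ∣ subspaceEval p L u := by
  induction L with
  | nil => rfl
  | cons v L ih =>
    exact dvd_sub (dvd_pow ih hp.out.ne_zero) (ih.mul_left _)

variable [hp : Fact p.Prime] [CharP A p]

theorem subspaceEval_add (L : List A) (u v : A) :
    subspaceEval p L (u + v) = subspaceEval p L u + subspaceEval p L v := by
  induction L generalizing u v with
  | nil => rfl
  | cons w L ih => simp only [subspaceEval, ih, add_pow_char]; ring

/-- `subspaceEval` as an additive map. -/
def subspaceHom (L : List A) : A →+ A := AddMonoidHom.mk' _ (subspaceEval_add p L)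

theorem sub_pow_prime_sub_one_comm (X Y : A) : (Y - X) ^ (p - 1) = (X - Y) ^ (p - 1) := by
  have h : (-1 : A) ^ (p - 1) = 1 := by
    have h1 := pow_sub_one_mul hp.out.ne_zero (-1 : A)
    rw [neg_one_pow_char A p] at h1
    linear_combination -h1
  rw [← neg_sub, neg_pow, h, one_mul]

theorem pow_add_mul_sub_pow_comm (X Y : A) :
    Y ^ p + X * (X - Y) ^ (p - 1) = X ^ p + Y * (Y - X) ^ (p - 1) := by
  have h : (X - Y) ^ (p - 1) * (X - Y) = X ^ p - Y ^ p := by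
    rw [pow_sub_one_mul hp.out.ne_zero, sub_pow_char]
  rw [sub_pow_prime_sub_one_comm p X Y]
  linear_combination h

theorem subspaceEval_perm {L L' : List A} (h : L.Perm L') :
    subspaceEval p L = subspaceEval p L' := by
  induction h with
  | nil => rfl
  | cons v _ ih => funext u; simp only [subspaceEval, ih]
  | trans _ _ ih₁ ih₂ => exact ih₁.trans ih₂
  | swap v w L =>
    funext u
    simp only [subspaceEval]
    generalize subspaceEval p L u = x
    generalize subspaceEval p L v = y
    generalize subspaceEval p L w = z
    have key (y z : A) : (z ^ p - y ^ (p - 1) * z) ^ (p - 1) =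
        z ^ (p - 1) * (z ^ (p - 1) - y ^ (p - 1)) ^ (p - 1) := by
      rw [← mul_pow, ← pow_sub_one_mul hp.out.ne_zero z]
      ring
    rw [key, key, sub_pow_char (p := p), sub_pow_char (p := p), mul_pow, mul_pow]
    linear_combination (x ^ p) * pow_add_mul_sub_pow_comm p (y ^ (p - 1)) (z ^ (p - 1)) +
      y ^ (p - 1) * z ^ (p - 1) * x *
        sub_pow_prime_sub_one_comm p (y ^ (p - 1)) (z ^ (p - 1))

theorem subspaceEval_eq_zero_of_mem {L : List A} {v : A} (h : v ∈ L) :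
    subspaceEval p L v = 0 := by
  classical
  rw [subspaceEval_perm p (List.perm_cons_erase h), subspaceEval,
    pow_sub_one_mul hp.out.ne_zero, sub_self]

theorem exists_intCast_mul_eq [IsDomain A] {x w : A} (h : x ^ p = w ^ (p - 1) * x) :
    ∃ k : ℤ, x = k * w := by
  rcases eq_or_ne w 0 with rfl | hw
  · have : p - 1 ≠ 0 := (Nat.sub_pos_of_lt hp.out.one_lt).ne'
    rw [zero_pow this, zero_mul] at h
    exact ⟨0, by simpa using eq_zero_of_pow_eq_zero h⟩
  let F := FractionRing A
  have inj := IsFractionRing.injective A F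
  have : CharP F p := charP_of_injective_algebraMap inj p
  have hw' : algebraMap A F w ≠ 0 := by simpa using hw
  have h1 : (algebraMap A F x / algebraMap A F w) ^ p = algebraMap A F x / algebraMap A F w := by
    have := congrArg (algebraMap A F) h
    simp only [map_mul, map_pow] at this
    rw [div_pow, this, ← pow_sub_one_mul hp.out.ne_zero (algebraMap A F w),
      mul_div_mul_left _ _ (pow_ne_zero _ hw')]
  obtain ⟨k, hk⟩ :=
    (mem_bot_iff_intCast p F).1 ((Subfield.mem_bot_iff_pow_eq_self F p).2 h1)
  refine ⟨k, inj ?_⟩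
  rw [eq_div_iff hw'] at hk
  simpa using hk.symm

theorem map_eq_zero_of_subspaceEval_eq_zero [IsDomain A] {C : Type*} [AddCommGroup C]
    (f : A →+ C) {L : List A} (hL : ∀ v ∈ L, f v = 0) {u : A} (hu : subspaceEval p L u = 0) :
    f u = 0 := by
  induction L generalizing u with
  | nil => simp_all [subspaceEval]
  | cons v L ih =>
    obtain ⟨k, hk⟩ := exists_intCast_mul_eq p (sub_eq_zero.1 hu)
    have h1 : subspaceEval p L (u - k • v) = 0 := by
      have := (subspaceHom p L).map_sub u (k • v)
      rw [map_zsmul] at this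
      simpa [subspaceHom, hk] using this
    have h2 := ih (fun w hw => hL w (List.mem_cons_of_mem _ hw)) h1
    simpa only [map_sub, map_zsmul, hL v List.mem_cons_self, smul_zero, sub_zero] using h2

end SubspacePolynomial

theorem exists_dvd_pow_of_ne_zero {F O : Type*} [Field F] [CommRing O] [IsLocalRing O]
    (φ : F[X] →+* O) (hφ : φ X ∈ IsLocalRing.maximalIdeal O) {f : F[X]} (hf : f ≠ 0) :
    ∃ M, φ f ∣ φ X ^ M := by
  obtain ⟨g, hg, hX⟩ := exists_eq_pow_rootMultiplicity_mul_and_not_dvd f hf 0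
  refine ⟨rootMultiplicity 0 f, ?_⟩
  have hu : IsUnit (φ g) := by
    have h0 : g.coeff 0 ≠ 0 := by simpa [X_dvd_iff] using hX
    rw [← g.divX_mul_X_add, map_add, map_mul]
    have h1 : IsUnit (φ (C (g.coeff 0))) := ((isUnit_iff_ne_zero.2 h0).map C).map φ
    by_contra hn
    exact (IsLocalRing.mem_maximalIdeal _).1
      ((Ideal.add_mem_iff_right _ (Ideal.mul_mem_left _ _ hφ)).1
        ((IsLocalRing.mem_maximalIdeal _).2 hn)) h1
  rw [C_0, sub_zero] at hg
  conv_lhs => rw [hg]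
  rw [map_mul, map_pow]
  exact hu.mul_right_dvd.2 dvd_rfl

theorem IsLocalRing.exists_mul_one_add_pow_eq_one {O : Type*} [CommRing O] [IsLocalRing O] {c : O}
    (hc : c ∈ IsLocalRing.maximalIdeal O) {N : ℕ} (hN : N ≠ 0) :
    ∃ r, (1 + c ^ N) * r = 1 := by
  apply IsUnit.exists_right_inv
  by_contra hn
  exact (IsLocalRing.mem_maximalIdeal _).1
    ((Ideal.add_mem_iff_left _ (Ideal.pow_mem_of_mem _ hc N (Nat.pos_of_ne_zero hN))).1
        ((IsLocalRing.mem_maximalIdeal _).2 hn)) isUnit_one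

theorem exists_mem_maximalIdeal_of_incomparable {K : Type*} [Field K] {O₁ O₂ : ValuationSubring K}
    (h₁ : ¬ O₁ ≤ O₂) (h₂ : ¬ O₂ ≤ O₁) :
    ∃ c ∈ IsLocalRing.maximalIdeal O₁, ∃ d ∈ IsLocalRing.maximalIdeal O₂, (c * d : K) = 1 := by
  obtain ⟨a, ha₁, ha₂⟩ := SetLike.not_le_iff_exists.1 h₁
  obtain ⟨b, hb₂, hb₁⟩ := SetLike.not_le_iff_exists.1 h₂
  have ha : a ≠ 0 := by rintro rfl; exact ha₂ O₂.zero_mem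
  have hb : b ≠ 0 := by rintro rfl; exact hb₁ O₁.zero_mem
  have key (O : ValuationSubring K) {x y : K} (hx : x ∈ O) (hy : y ∉ O) :
      ∃ c ∈ IsLocalRing.maximalIdeal O, (c : K) = x / y := by
    have hlt : O.valuation (x / y) < 1 := by
      rw [map_div₀]
      have h1 := (O.valuation_le_one_iff x).2 hx
      have h2 := lt_of_not_ge (mt (O.valuation_le_one_iff y).1 hy)
      exact (div_lt_one₀ (zero_lt_one.trans h2)).2 (h1.trans_lt h2)
    exact ⟨⟨x / y, (O.valuation_le_one_iff _).1 hlt.le⟩, (O.valuation_lt_one_iff _).2 hlt, rfl⟩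
  obtain ⟨c, hc, hc'⟩ := key O₁ ha₁ hb₁
  obtain ⟨d, hd, hd'⟩ := key O₂ hb₂ ha₂
  refine ⟨c, hc, d, hd, ?_⟩
  rw [hc', hd']
  field_simp

theorem exists_approximation_of_incomparable {K : Type*} [Field K] {O₁ O₂ : ValuationSubring K}
    (h₁ : ¬ O₁ ≤ O₂) (h₂ : ¬ O₂ ≤ O₁) :
    ∃ e₁ ∈ IsLocalRing.maximalIdeal O₁, ∃ e₂ ∈ IsLocalRing.maximalIdeal O₂, (e₁ : K) = e₂ ∧
      e₁ ≠ 0 ∧ ∀ N ≠ 0, ∃ (t₁ : O₁) (t₂ : O₂), (e₁ ^ N * t₁ + e₂ ^ N * t₂ : K) = 1 := by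
  obtain ⟨c, hc, d, hd, hcd⟩ := exists_mem_maximalIdeal_of_incomparable h₁ h₂
  obtain ⟨r, hr⟩ := IsLocalRing.exists_mul_one_add_pow_eq_one hc two_ne_zero
  obtain ⟨s, hs⟩ := IsLocalRing.exists_mul_one_add_pow_eq_one hd two_ne_zero
  have hr' : (1 + c ^ 2 : K) * r = 1 := by exact_mod_cast congrArg ((↑) : O₁ → K) hr
  have hs' : (1 + d ^ 2 : K) * s = 1 := by exact_mod_cast congrArg ((↑) : O₂ → K) hs
  have hc0 : (c : K) ≠ 0 := left_ne_zero_of_mul_eq_one hcd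
  have hr0 : (r : K) ≠ 0 := right_ne_zero_of_mul_eq_one hr'
  refine ⟨c * r, Ideal.mul_mem_right _ _ hc, d * s, Ideal.mul_mem_right _ _ hd, ?_, ?_, ?_⟩
  · push_cast
    linear_combination (d * s : K) * hr' - (c * r : K) * hs' + (r * s * (d - c) : K) * hcd
  · intro h
    have := congrArg ((↑) : O₁ → K) h
    simp_all
  · intro N hN
    obtain ⟨r', hrN⟩ := IsLocalRing.exists_mul_one_add_pow_eq_one hc hN
    obtain ⟨s', hsN⟩ := IsLocalRing.exists_mul_one_add_pow_eq_one hd hN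
    have hrN' : (1 + c ^ N : K) * r' = 1 := by exact_mod_cast congrArg ((↑) : O₁ → K) hrN
    have hsN' : (1 + d ^ N : K) * s' = 1 := by exact_mod_cast congrArg ((↑) : O₂ → K) hsN
    refine ⟨(1 + c ^ 2) ^ N * r', (1 + d ^ 2) ^ N * s', ?_⟩
    push_cast
    have e1 : (c * r : K) ^ N * ((1 + c ^ 2) ^ N * r') = c ^ N * r' := by
      rw [← mul_assoc, ← mul_pow]
      congr 2
      linear_combination (c : K) * hr'
    have e2 : (d * s : K) ^ N * ((1 + d ^ 2) ^ N * s') = d ^ N * s' := by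
      rw [← mul_assoc, ← mul_pow]
      congr 2
      linear_combination (d : K) * hs'
    have hN1 : (c : K) ^ N * d ^ N = 1 := by rw [← mul_pow, hcd, one_pow]
    rw [e1, e2]
    linear_combination hrN' + (r' : K) * hsN' + (s' : K) * hrN' - (1 + d ^ N) * s' * hrN' +
      (r' * s' : K) * hN1

theorem exists_dvd_subspaceEval {O : Type*} [CommRing O] [IsLocalRing O] (p : ℕ)
    [Fact p.Prime] (φ : (ZMod p)[X] →+* O) (hφ : φ X ∈ IsLocalRing.maximalIdeal O) {f : (ZMod p)[X]}
    (hf : f ≠ 0) :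
    ∃ M, ∀ N ≥ M, ∀ (L : List O) (u : O), φ X ^ N ∣ u → φ X * φ f ∣ subspaceEval p L u := by
  obtain ⟨M, hM⟩ := exists_dvd_pow_of_ne_zero φ hφ hf
  refine ⟨M + 1, fun N hN L u hu => ?_⟩
  refine Dvd.dvd.trans ?_ ((pow_dvd_pow _ hN).trans (hu.trans (dvd_subspaceEval p L u)))
  rw [pow_succ']
  exact mul_dvd_mul_left _ hM

/-- The powers `X ^ j` with `j < n` and `j ≠ i`. -/
noncomputable def otherPowers (p n i : ℕ) : List (ZMod p)[X] :=
  ((List.range n).erase i).map (X ^ ·)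

theorem subspaceEval_otherPowers_ne_zero (p : ℕ) [Fact p.Prime] (n i : ℕ) :
    subspaceEval p (otherPowers p n i) (X ^ i) ≠ 0 := by
  intro h
  have := map_eq_zero_of_subspaceEval_eq_zero p (lcoeff (ZMod p) i).toAddMonoidHom
    (fun v hv => ?_) h
  · simp at this
  · obtain ⟨j, hj, rfl⟩ := List.mem_map.1 hv
    have : j ≠ i := ((List.nodup_range).mem_erase_iff.1 hj).1
    simp [coeff_X_pow, this.symm]

theorem subspaceEval_otherPowers_sum (p : ℕ) [Fact p.Prime] {n i : ℕ} {s : Finset ℕ}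
    (hs : s ⊆ Finset.range n) :
    subspaceEval p (otherPowers p n i) (∑ j ∈ s, X ^ j) =
      if i ∈ s then subspaceEval p (otherPowers p n i) (X ^ i) else 0 := by
  rw [← Finset.sum_ite_eq' s i fun _ => subspaceEval p (otherPowers p n i) (X ^ i)]
  refine (map_sum (subspaceHom p (otherPowers p n i)) _ _).trans (Finset.sum_congr rfl ?_)
  intro j hj
  split_ifs with h
  · rw [h]; rfl
  · exact subspaceEval_eq_zero_of_mem p
      (List.mem_map.2 ⟨j, (List.mem_erase_of_ne h).2
        (List.mem_range.2 (Finset.mem_range.1 (hs hj))), rfl⟩)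

theorem eq_zero_of_pow_eq_self {O : Type*} [CommRing O] [IsLocalRing O] [IsDomain O] {p : ℕ}
    (hp : p.Prime) {t : O} (ht : t ∈ IsLocalRing.maximalIdeal O) (h : t ^ p = t) : t = 0 := by
  by_contra h0
  have h1 : t ^ (p - 1) = 1 := mul_right_cancel₀ h0 (by rw [pow_sub_one_mul hp.ne_zero, h, one_mul])
  exact (IsLocalRing.mem_maximalIdeal _).1 ht
    (IsUnit.of_pow_eq_one h1 (Nat.sub_pos_of_lt hp.one_lt).ne')

theorem exists_shattered_of_incomparable {K : Type*} [Field K] {O₁ O₂ : ValuationSubring K}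
    (p : ℕ) [hp : Fact p.Prime] [CharP K p] (h₁ : ¬ O₁ ≤ O₂) (h₂ : ¬ O₂ ≤ O₁) (n : ℕ) :
    ∃ (a b : ℕ → K) (y : Set ℕ → K), ∀ i < n, ∀ S : Set ℕ,
      (∃ z, y S + b i * z = a i * z ^ p ∧ z ∈ O₁ ∧ z ∈ O₂) ↔ i ∈ S := by
  classical
  obtain ⟨e₁, he₁, e₂, he₂, hee, he0, hN⟩ := exists_approximation_of_incomparable h₁ h₂
  have : CharP O₁ p := (RingHom.charP_iff O₁.subtype Subtype.val_injective p).2 ‹_›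
  have : CharP O₂ p := (RingHom.charP_iff O₂.subtype Subtype.val_injective p).2 ‹_›
  let φ₁ : (ZMod p)[X] →+* O₁ := eval₂RingHom (ZMod.castHom dvd_rfl O₁) e₁
  let φ₂ : (ZMod p)[X] →+* O₂ := eval₂RingHom (ZMod.castHom dvd_rfl O₂) e₂
  let ψ : (ZMod p)[X] →+* K := O₁.subtype.comp φ₁
  have hψ : ψ = O₂.subtype.comp φ₂ := by
    refine ringHom_ext' (Subsingleton.elim _ _) ?_
    simpa [ψ, φ₁, φ₂] using hee
  have hφ₁ : φ₁ X = e₁ := by simp [φ₁]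
  have hφ₂ : φ₂ X = e₂ := by simp [φ₂]
  let h (i : ℕ) : (ZMod p)[X] := subspaceEval p (otherPowers p n i) (X ^ i)
  let f : (ZMod p)[X] := ∏ i ∈ Finset.range n, h i
  have hf : f ≠ 0 := Finset.prod_ne_zero_iff.2 fun i _ => subspaceEval_otherPowers_ne_zero p n i
  obtain ⟨M₁, hM₁⟩ := exists_dvd_subspaceEval p φ₁ (hφ₁ ▸ he₁) hf
  obtain ⟨M₂, hM₂⟩ := exists_dvd_subspaceEval p φ₂ (hφ₂ ▸ he₂) hf
  obtain ⟨t₁, t₂, ht⟩ := hN (M₁ + M₂ + 1) (by omega)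
  have hψ0 : ∀ i, ψ (h i) ≠ 0 := by
    intro i hi
    have hi' : φ₁ (h i) = 0 := Subtype.val_injective hi
    obtain ⟨M, hM⟩ := exists_dvd_pow_of_ne_zero φ₁ (hφ₁ ▸ he₁)
      (subspaceEval_otherPowers_ne_zero p n i)
    rw [hi', zero_dvd_iff, hφ₁] at hM
    exact he0 (eq_zero_of_pow_eq_zero hM)
  obtain ⟨e, he⟩ : ∃ e : K, e = e₁ := ⟨_, rfl⟩
  rw [← he] at hee ht
  have he0' : e ≠ 0 := by simpa [he] using he0
  let v (S : Set ℕ) : (ZMod p)[X] := ∑ j ∈ (Finset.range n).filter (· ∉ S), X ^ j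
  let u (S : Set ℕ) : K := ψ (v S) * (e ^ (M₁ + M₂ + 1) * t₂)
  let P (i : ℕ) : K → K := subspaceEval p ((otherPowers p n i).map ψ)
  let Q : K → K := subspaceEval p (((List.range n).map (X ^ ·)).map ψ)
  refine ⟨fun i => (ψ (h i) * e) ^ p, fun i => ψ (h i) ^ p * e, fun S => Q (u S), ?_⟩
  intro i hi S
  have hQP (x : K) : Q x = P i x ^ p - ψ (h i) ^ (p - 1) * P i x := by
    have hperm : List.Perm (((List.range n).map (X ^ ·)).map ψ)
        (ψ (X ^ i) :: (otherPowers p n i).map ψ) :=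
      ((List.perm_cons_erase (List.mem_range.2 hi)).map _).map _
    simp only [Q, P, h, subspaceEval_perm p hperm, map_subspaceEval, subspaceEval]
  have hdvd : h i ∣ f := Finset.dvd_prod_of_mem h (Finset.mem_range.2 hi)
  obtain ⟨z₂, hz₂⟩ : ∃ z : O₂, P i (u S) = e * ψ (h i) * z := by
    obtain ⟨z, hz⟩ := (mul_dvd_mul_left _ (map_dvd φ₂ hdvd)).trans
      (hM₂ (M₁ + M₂ + 1) (by omega) ((otherPowers p n i).map φ₂)
        (φ₂ (v S) * (e₂ ^ (M₁ + M₂ + 1) * t₂)) (hφ₂ ▸ (dvd_mul_right _ _).mul_left _))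
    refine ⟨z, ?_⟩
    have := congrArg O₂.subtype hz
    rw [map_subspaceEval] at this
    simpa [P, u, hψ, hφ₂, hee, Function.comp_def] using this
  obtain ⟨w, hw⟩ : ∃ w : O₁, P i (ψ (v S)) - P i (u S) = e * ψ (h i) * w := by
    obtain ⟨z, hz⟩ := (mul_dvd_mul_left _ (map_dvd φ₁ hdvd)).trans
      (hM₁ (M₁ + M₂ + 1) (by omega) ((otherPowers p n i).map φ₁)
        (φ₁ (v S) * (e₁ ^ (M₁ + M₂ + 1) * t₁)) (hφ₁ ▸ (dvd_mul_right _ _).mul_left _))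
    refine ⟨z, ?_⟩
    have h1 : ψ (v S) - u S = ψ (v S) * (e ^ (M₁ + M₂ + 1) * t₁) := by
      rw [← hee] at ht
      linear_combination -ψ (v S) * ht
    have h2 : P i (ψ (v S)) - P i (u S) = P i (ψ (v S) - u S) :=
      ((subspaceHom p ((otherPowers p n i).map ψ)).map_sub _ _).symm
    have := congrArg O₁.subtype hz
    rw [map_subspaceEval] at this
    rw [h2, h1]
    simpa [P, ψ, hφ₁, he, Function.comp_def] using this
  have hPv : P i (ψ (v S)) = if i ∈ S then 0 else ψ (h i) := by
    simp only [P, ← map_subspaceEval, v,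
      subspaceEval_otherPowers_sum p (Finset.filter_subset _ (Finset.range n)), h]
    by_cases hS : i ∈ S <;> simp [hS, hi]
  have hzp : Q (u S) + ψ (h i) ^ p * e * z₂ = (ψ (h i) * e) ^ p * (z₂ : K) ^ p := by
    rw [hQP, hz₂]
    linear_combination -(e * z₂) * pow_sub_one_mul hp.out.ne_zero (ψ (h i))
  constructor
  · rintro ⟨z, hz, hzO₁, hzO₂⟩
    have hzz : z = z₂ := by
      have hd : (e₂ * (⟨z, hzO₂⟩ - z₂)) ^ p = e₂ * (⟨z, hzO₂⟩ - z₂) := by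
        apply Subtype.val_injective
        push_cast
        rw [← hee]
        apply mul_left_cancel₀ (pow_ne_zero p (hψ0 i))
        rw [mul_sub, sub_pow_char]
        linear_combination hzp - hz
      have := congrArg O₂.subtype (eq_zero_of_pow_eq_self hp.out (Ideal.mul_mem_right _ _ he₂) hd)
      have h0 : e * (z - z₂) = 0 := by rw [hee]; exact this
      exact sub_eq_zero.1 ((mul_eq_zero.1 h0).resolve_left he0')
    by_contra hS
    rw [if_neg hS] at hPv
    have h1 : e₁ * (⟨z, hzO₁⟩ + w) = 1 := by
      apply Subtype.val_injective
      push_cast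
      apply mul_left_cancel₀ (hψ0 i)
      rw [hzz, ← he]
      linear_combination -hz₂ - hw + hPv
    exact (IsLocalRing.mem_maximalIdeal _).1 he₁ (IsUnit.of_mul_eq_one _ h1)
  · intro hS
    refine ⟨z₂, hzp, ?_, z₂.2⟩
    rw [if_pos hS] at hPv
    have h1 : (z₂ : K) = -w := by
      apply mul_left_cancel₀ (mul_ne_zero he0' (hψ0 i))
      linear_combination -hz₂ - hw + hPv
    rw [h1]
    exact neg_mem w.2

end Algebra

/-- Interpreting the ring symbols of `ringPredLang` on terms. -/
def liftTerm {α : Type} (t : Language.ring.Term α) : ringPredLang.Term α :=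
  LHom.onTerm (L' := ringPredLang) LHom.sumInl t

/-- The atomic formula `t ∈ O₁` (for `b = true`) or `t ∈ O₂` (for `b = false`). -/
def memFormula {α : Type} {k : ℕ} (b : Bool) (t : ringPredLang.Term (α ⊕ Fin k)) :
    ringPredLang.BoundedFormula α k :=
  Relations.boundedFormula₁ (L := ringPredLang) (Sum.inr b : ringPredLang.Relations 1) t

/-- The formula `∃ z, y + b z = a z ^ p ∧ z ∈ O₁ ∧ z ∈ O₂` in the variables `(a, b; y)`. -/
noncomputable def twistedFormula (p : ℕ) : ringPredLang.Formula (Fin 2 ⊕ Fin 1) :=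
  let x (i : (Fin 2 ⊕ Fin 1) ⊕ Fin 1) : FreeCommRing ((Fin 2 ⊕ Fin 1) ⊕ Fin 1) := FreeCommRing.of i
  let y := x (.inl (.inr 0))
  let a := x (.inl (.inl 0))
  let b := x (.inl (.inl 1))
  let z := x (.inr 0)
  BoundedFormula.ex
    ((liftTerm (FirstOrder.Ring.termOfFreeCommRing (y + b * z))).bdEqual
        (liftTerm (FirstOrder.Ring.termOfFreeCommRing (a * z ^ p))) ⊓
      (memFormula true (Term.var (.inr 0)) ⊓ memFormula false (Term.var (.inr 0))))

theorem isExistential_twistedFormula (p : ℕ) : IsExistential (twistedFormula p) := by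
  refine IsEA.ex (IsEA.of_isQF ?_)
  refine .inf (BoundedFormula.IsAtomic.equal _ _).isQF (.inf ?_ ?_) <;>
    exact (BoundedFormula.IsAtomic.rel _ _).isQF

theorem realize_liftTerm {K : Type} [Field K] {O₁ O₂ : ValuationSubring K} {α : Type}
    (t : Language.ring.Term α) (v : α → K) :
    letI := valuedFieldStructure K O₁ O₂
    letI := FirstOrder.Ring.compatibleRingOfRing K
    (liftTerm t).realize v = t.realize v := by
  let _ := FirstOrder.Ring.compatibleRingOfRing K
  let _ := valuedFieldStructure K O₁ O₂
  have : @LHom.IsExpansionOn Language.ring ringPredLang LHom.sumInl K _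
      (valuedFieldStructure K O₁ O₂) :=
    ⟨fun _ _ => rfl, fun _ _ => rfl⟩
  exact LHom.realize_onTerm (L' := ringPredLang) _ t v

theorem realize_twistedFormula {K : Type} [Field K] {O₁ O₂ : ValuationSubring K} (p : ℕ)
    (v : Fin 2 → K) (y : Fin 1 → K) :
    letI := valuedFieldStructure K O₁ O₂
    (twistedFormula p).Realize (Sum.elim v y) ↔
      ∃ z, y 0 + v 1 * z = v 0 * z ^ p ∧ z ∈ O₁ ∧ z ∈ O₂ := by
  let _ := valuedFieldStructure K O₁ O₂
  let _ := FirstOrder.Ring.compatibleRingOfRing K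
  simp only [twistedFormula, Formula.Realize, BoundedFormula.realize_ex, BoundedFormula.realize_inf,
    BoundedFormula.realize_bdEqual]
  refine exists_congr fun z => and_congr ?_ (and_congr Iff.rfl Iff.rfl)
  rw [realize_liftTerm, realize_liftTerm, FirstOrder.Ring.realize_termOfFreeCommRing,
    FirstOrder.Ring.realize_termOfFreeCommRing]
  simp [FreeCommRing.lift_of, Fin.snoc]

open Filter in
theorem Theory.hasIP_completeTheory {L : FirstOrder.Language.{0, 0}} {K : Type} [L.Structure K]
    [Nonempty K] {α β : Type} (φ : L.Formula (α ⊕ β))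
    (h : ∀ n : ℕ, ∃ (a : ℕ → α → K) (b : Set ℕ → β → K), ∀ i < n, ∀ S : Set ℕ,
      φ.Realize (Sum.elim (a i) (b S)) ↔ i ∈ S) :
    Theory.HasIP (L.completeTheory K) φ := by
  choose a b hab using h
  let U : Ultrafilter ℕ := hyperfilter ℕ
  let mk (x : ℕ → K) : (U : Filter ℕ).Product (fun _ => K) := (x : Filter.Product _ _)
  have hM : (U : Filter ℕ).Product (fun _ => K) ⊨ L.completeTheory K := by
    refine ⟨fun σ hσ => ?_⟩
    rw [Ultraproduct.sentence_realize]
    exact Eventually.of_forall fun _ => hσ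
  refine ⟨Theory.ModelType.of _ ((U : Filter ℕ).Product (fun _ => K)),
    fun i x => mk fun n => a n i x, fun S x => mk fun n => b n S x, ?_⟩
  intro i S
  have key := Ultraproduct.realize_formula_cast (u := U) φ
    (Sum.elim (fun x n => a n i x) (fun x n => b n S x))
  have h1 : (fun j => mk (Sum.elim (fun x n => a n i x) (fun x n => b n S x) j) :
      α ⊕ β → (U : Filter ℕ).Product (fun _ => K)) =
      Sum.elim (fun x => mk fun n => a n i x)
        (fun x => mk fun n => b n S x) := by
    funext y; revert y; rintro (x | x) <;> rfl
  change φ.Realize (fun j => mk _) ↔ _ at key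
  rw [h1] at key
  refine key.trans ?_
  have h2 : ∀ᶠ n in (U : Filter ℕ), (φ.Realize fun j =>
      Sum.elim (fun x n => a n i x) (fun x n => b n S x) j n) ↔ i ∈ S := by
    filter_upwards [Nat.hyperfilter_le_atTop (eventually_gt_atTop i)] with n hn
    rw [← hab n i hn S]
    apply iff_of_eq
    congr 1
    ext (x | x) <;> rfl
  rw [eventually_congr h2, eventually_const]

/-- **Statement 18.** Let `K = (K, O₁, O₂)` be a field of characteristic `p > 0` equipped
with two valuation rings `O₁` and `O₂`, viewed as a structure in the language of rings
expanded by two unary predicates for `O₁` and `O₂`.  If every existential formula of this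
language is NIP with respect to `Th(K)`, then `O₁` and `O₂` are comparable. -/
theorem comparable_of_exNIP_of_char_pos
    (K : Type) [Field K] (O₁ O₂ : ValuationSubring K)
    (p : ℕ) (hp : p.Prime) (hchar : CharP K p)
    (hNIP : Theory.IsExNIP (valuedFieldTheory K O₁ O₂)) :
    O₁ ≤ O₂ ∨ O₂ ≤ O₁ := by
  by_contra! hcon
  have : Fact p.Prime := ⟨hp⟩
  let _ := valuedFieldStructure K O₁ O₂
  refine hNIP 2 1 (twistedFormula p) (isExistential_twistedFormula p)
    (Theory.hasIP_completeTheory _ fun n => ?_)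
  obtain ⟨a, b, y, h⟩ := exists_shattered_of_incomparable p hcon.1 hcon.2 n
  exact ⟨fun i => ![a i, b i], fun S => ![y S], fun i hi S =>
    (realize_twistedFormula p _ _).trans (h i hi S)⟩

end NIPPaper
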